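/- Let X be a topological space with sobrification S and sobrification map ξ : X → S, ξ(x) = closure({x}), and let R(X) be the class of subsets R ⊆ X such that R is 0-closed and ξ(R) is compact saturated in S. Then the following are equivalent: (i) X is quasisober; (ii) the sets in R(X) cover X (every point of X belongs to some element of R(X)); (iii) R(X) coincides with the class of compact saturated subsets of X. -/

import Mathlib

open TopologicalSpace Set

/-- The sobrification of a topological space `X`: the set of irreducible closed
subsets of `X`. -/
def Sobrification (X : Type*) [TopologicalSpace X] : Type _ :=
  {C : Set X // IsIrreducible C ∧ IsClosed C}

/-- For an open set `U ⊆ X`, the set `Û = {C ∈ S : C ∩ U ≠ ∅}`. -/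
def hatSet {X : Type*} [TopologicalSpace X] (U : Set X) : Set (Sobrification X) :=
  {C | (C.1 ∩ U).Nonempty}

/-- The topology on the sobrification, whose open sets are the sets `Û` for `U` open. -/
instance {X : Type*} [TopologicalSpace X] : TopologicalSpace (Sobrification X) :=
  TopologicalSpace.generateFrom {s | ∃ U : Set X, IsOpen U ∧ s = hatSet U}

/-- The sobrification map `ξ : X → S`, sending `x` to the closure of `{x}`. -/
def sobrMap {X : Type*} [TopologicalSpace X] (x : X) : Sobrification X :=
  ⟨closure {x}, isIrreducible_singleton.closure, isClosed_closure⟩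

/-- A subset of a topological space is saturated if it is an intersection of open sets. -/
def IsSaturatedSet {X : Type*} [TopologicalSpace X] (A : Set X) : Prop :=
  ∃ 𝒰 : Set (Set X), (∀ U ∈ 𝒰, IsOpen U) ∧ A = ⋂₀ 𝒰

/-- A subset `A` of `X` is `0`-closed if whenever `x ∈ A` and `y` has the same
closure as `x`, then `y ∈ A`. -/
def IsZeroClosed {X : Type*} [TopologicalSpace X] (A : Set X) : Prop :=
  ∀ x ∈ A, ∀ y : X, closure {y} = closure ({x} : Set X) → y ∈ A

/-- The class `R(X)` of `0`-closed subsets whose image under the sobrification map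
is compact saturated in the sobrification. -/
def RClass (X : Type*) [TopologicalSpace X] : Set (Set X) :=
  {R | IsZeroClosed R ∧ IsCompact (sobrMap '' R) ∧ IsSaturatedSet (sobrMap '' R)}

/-- For a closed set `F ⊆ X`, the set `τ(F) = {C ∈ S : C ⊆ F}`. -/
def tauSet {X : Type*} [TopologicalSpace X] (F : Set X) : Set (Sobrification X) :=
  {C | C.1 ⊆ F}

section

variable {X : Type*} [TopologicalSpace X]

theorem sobrMap_eq_iff {x y : X} :
    sobrMap x = sobrMap y ↔ closure {x} = closure ({y} : Set X) :=
  Subtype.ext_iff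

theorem isOpen_hatSet {U : Set X} (hU : IsOpen U) : IsOpen (hatSet U) :=
  isOpen_generateFrom_of_mem ⟨U, hU, rfl⟩

theorem sobrMap_mem_hatSet {U : Set X} (hU : IsOpen U) {x : X} :
    sobrMap x ∈ hatSet U ↔ x ∈ U :=
  (isGenericPoint_closure.mem_open_set_iff hU).symm

theorem sobrMap_preimage_hatSet {U : Set X} (hU : IsOpen U) : sobrMap ⁻¹' hatSet U = U :=
  Set.ext fun _ ↦ sobrMap_mem_hatSet hU

theorem continuous_sobrMap : Continuous (sobrMap : X → Sobrification X) := by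
  refine continuous_generateFrom_iff.2 ?_
  rintro _ ⟨U, hU, rfl⟩
  rwa [sobrMap_preimage_hatSet hU]

theorem isInducing_sobrMap : Topology.IsInducing (sobrMap : X → Sobrification X) := by
  refine ⟨le_antisymm continuous_sobrMap.le_induced fun U hU ↦ ?_⟩
  exact isOpen_induced_iff.2 ⟨hatSet U, isOpen_hatSet hU, sobrMap_preimage_hatSet hU⟩

theorem Sobrification.specializes_sobrMap {C : Sobrification X} {x : X} (hx : x ∈ C.1) :
    C ⤳ sobrMap x := by
  refine specializes_iff_pure.2 ?_
  rw [nhds_generateFrom]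
  refine le_iInf₂ ?_
  rintro _ ⟨hxU, U, hU, rfl⟩
  exact Filter.le_principal_iff.2 ⟨x, hx, (sobrMap_mem_hatSet hU).1 hxU⟩

theorem sobrMap_surjective [QuasiSober X] :
    Function.Surjective (sobrMap : X → Sobrification X) := fun C ↦
  let ⟨x, hx⟩ := QuasiSober.sober C.2.1 C.2.2
  ⟨x, Subtype.ext hx⟩

theorem IsSaturatedSet.mem_of_specializes {A : Set X} (hA : IsSaturatedSet A) {x y : X}
    (h : y ⤳ x) (hx : x ∈ A) : y ∈ A := by
  obtain ⟨𝒰, h𝒰, rfl⟩ := hA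
  exact fun U hU ↦ h.mem_open (h𝒰 U hU) (hx U hU)

theorem IsSaturatedSet.isZeroClosed {A : Set X} (hA : IsSaturatedSet A) : IsZeroClosed A :=
  fun _ hx _ h ↦ hA.mem_of_specializes (specializes_iff_closure_subset.2 h.ge) hx

theorem isSaturatedSet_nhdsKer (A : Set X) : IsSaturatedSet (nhdsKer A) :=
  ⟨_, fun _ hU ↦ hU.1, nhdsKer_def A⟩

theorem IsSaturatedSet.preimage {Y : Type*} [TopologicalSpace Y] {f : X → Y}
    (hf : Continuous f) {B : Set Y} (hB : IsSaturatedSet B) : IsSaturatedSet (f ⁻¹' B) := by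
  obtain ⟨𝒱, h𝒱, rfl⟩ := hB
  refine ⟨Set.preimage f '' 𝒱, ?_, ?_⟩
  · rintro _ ⟨V, hV, rfl⟩
    exact (h𝒱 V hV).preimage hf
  · rw [sInter_image, preimage_sInter]

theorem IsZeroClosed.preimage_image_sobrMap {A : Set X} (hA : IsZeroClosed A) :
    sobrMap ⁻¹' (sobrMap '' A) = A := by
  refine (subset_preimage_image _ _).antisymm' ?_
  rintro y ⟨x, hx, hxy⟩
  exact hA x hx y (sobrMap_eq_iff.1 hxy.symm)

theorem IsSaturatedSet.image_sobrMap [QuasiSober X] {A : Set X} (hA : IsSaturatedSet A) :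
    IsSaturatedSet (sobrMap '' A) := by
  obtain ⟨𝒰, h𝒰, rfl⟩ := hA
  refine ⟨hatSet '' 𝒰, ?_, ?_⟩
  · rintro _ ⟨U, hU, rfl⟩
    exact isOpen_hatSet (h𝒰 U hU)
  · rw [← image_preimage_eq (⋂₀ (hatSet '' 𝒰)) sobrMap_surjective, sInter_image,
      preimage_iInter₂, sInter_eq_biInter]
    exact congrArg _ (iInter₂_congr fun U hU ↦ (sobrMap_preimage_hatSet (h𝒰 U hU)).symm)

theorem isCompact_and_isSaturatedSet_of_mem_RClass {R : Set X} (hR : R ∈ RClass X) :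
    IsCompact R ∧ IsSaturatedSet R := by
  obtain ⟨hR₀, hRc, hRs⟩ := hR
  refine ⟨isInducing_sobrMap.isCompact_iff.2 hRc, ?_⟩
  simpa only [hR₀.preimage_image_sobrMap] using hRs.preimage continuous_sobrMap

theorem RClass_eq_of_quasiSober [QuasiSober X] :
    RClass X = {Q : Set X | IsCompact Q ∧ IsSaturatedSet Q} :=
  Set.ext fun _ ↦ ⟨isCompact_and_isSaturatedSet_of_mem_RClass, fun ⟨hc, hs⟩ ↦
    ⟨hs.isZeroClosed, hc.image continuous_sobrMap, hs.image_sobrMap⟩⟩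

theorem quasiSober_of_RClass_cover (h : ∀ x : X, ∃ R ∈ RClass X, x ∈ R) : QuasiSober X where
  sober {C} hC hC' := by
    obtain ⟨x, hx⟩ := hC.nonempty
    obtain ⟨R, ⟨-, -, hRs⟩, hxR⟩ := h x
    obtain ⟨y, -, hy⟩ := hRs.mem_of_specializes
      (Sobrification.specializes_sobrMap (C := ⟨C, hC, hC'⟩) hx) (mem_image_of_mem _ hxR)
    exact ⟨y, congrArg Subtype.val hy⟩

end

/-- `X` is quasisober iff the sets of `R(X)` cover `X` iff `R(X)` coincides with the
class of compact saturated subsets of `X`. -/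
theorem quasiSober_tfae (X : Type*) [TopologicalSpace X] :
    [QuasiSober X,
     ∀ x : X, ∃ R ∈ RClass X, x ∈ R,
     RClass X = {Q : Set X | IsCompact Q ∧ IsSaturatedSet Q}].TFAE := by
  tfae_have 1 → 3 := fun _ ↦ RClass_eq_of_quasiSober
  tfae_have 3 → 2 := fun h x ↦
    ⟨nhdsKer {x}, h ▸ ⟨isCompact_singleton.nhdsKer, isSaturatedSet_nhdsKer _⟩,
      subset_nhdsKer rfl⟩
  tfae_have 2 → 1 := quasiSober_of_RClass_cover
  tfae_finish
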